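/- In the coordinate ARH(1) estimation model, assume additionally that E[η_j(i)²] = 1 for all j ≥ 1 and i ≥ 0, and set σ_X := √( Σ_{j≥1} C_j ). Then for every n ≥ 2 the prediction error satisfies E[ √( Σ_{j=1}^{k_n} (ρ_j − ρ̂_{n,j})² C_j η_j(n−1)² + Σ_{j=k_n+1}^{∞} ρ_j² C_j η_j(n−1)² ) ] ≤ σ_X · √(g(n)), where g(n) := ( 2 S (n/(n−1))² / (C_{k_n}² n) ) · Σ_{j=1}^{k_n} C_j² + Σ_{j=k_n+1}^{∞} ρ_j²; in particular this expectation tends to 0 as n → ∞. (The random variable inside the expectation equals ‖(ρ − ρ̂_{k_n})(X_{n−1})‖_H for the diagonal model with coordinates X_{n−1,j} = √(C_j) η_j(n−1).) -/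

import Mathlib

open MeasureTheory Filter

/-- The componentwise moment-based estimator
`ρ̂_{n,j} = (n/(n-1)) · (Σ_{i=0}^{n-2} η_j(i) η_j(i+1)) / (Σ_{i=0}^{n-1} η_j(i)²)`. -/
noncomputable def rhoHat {Ω : Type*} (η : ℕ → ℕ → Ω → ℝ) (n j : ℕ) (ω : Ω) : ℝ :=
  (n : ℝ) / ((n : ℝ) - 1) *
    (∑ i ∈ Finset.range (n - 1), η j i ω * η j (i + 1) ω) /
    ∑ i ∈ Finset.range n, η j i ω ^ 2

section Integral

variable {Ω : Type*} [MeasurableSpace Ω] {P : Measure Ω}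

/-- A series of nonnegative integrable functions with summable integrals converges almost
everywhere, and its sum is integrable. -/
lemma ae_summable_and_integrable_tsum {F : ℕ → Ω → ℝ} (hF0 : ∀ j ω, 0 ≤ F j ω)
    (hF : ∀ j, Integrable (F j) P) (hsum : Summable fun j => ∫ ω, F j ω ∂P) :
    (∀ᵐ ω ∂P, Summable fun j => F j ω) ∧ Integrable (fun ω => ∑' j, F j ω) P := by
  have hmeas : ∀ j, AEMeasurable (fun ω => ENNReal.ofReal (F j ω)) P :=
    fun j => (hF j).aemeasurable.ennreal_ofReal
  have hfin : ∫⁻ ω, ∑' j, ENNReal.ofReal (F j ω) ∂P ≠ ⊤ := by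
    rw [lintegral_tsum hmeas]
    simp_rw [← ofReal_integral_eq_lintegral_ofReal (hF _) (ae_of_all _ (hF0 _))]
    exact hsum.tsum_ofReal_ne_top
  have htoReal : ∀ ω, (∑' j, ENNReal.ofReal (F j ω)).toReal = ∑' j, F j ω := fun ω => by
    rw [ENNReal.tsum_toReal_eq fun _ => ENNReal.ofReal_ne_top]
    simp_rw [ENNReal.toReal_ofReal (hF0 _ ω)]
  constructor
  · filter_upwards [ae_lt_top' (AEMeasurable.tsum hmeas) hfin] with ω hω
    simpa only [ENNReal.toReal_ofReal (hF0 _ ω)] using ENNReal.summable_toReal hω.ne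
  · simp_rw [← htoReal]
    exact integrable_toReal_of_lintegral_ne_top (AEMeasurable.tsum hmeas) hfin

lemma memLp_two_sqrt {f : Ω → ℝ} (hf0 : 0 ≤ f) (hf : Integrable f P) :
    MemLp (fun ω => √(f ω)) 2 P := by
  rw [memLp_two_iff_integrable_sq
    (Real.continuous_sqrt.comp_aestronglyMeasurable hf.aestronglyMeasurable)]
  simpa only [Real.sq_sqrt (hf0 _)] using hf

/-- The Cauchy-Schwarz inequality for the square root of a product. -/
lemma integral_sqrt_mul_sqrt_le {f g : Ω → ℝ} (hf0 : 0 ≤ f) (hg0 : 0 ≤ g)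
    (hf : Integrable f P) (hg : Integrable g P) :
    ∫ ω, √(f ω) * √(g ω) ∂P ≤ √(∫ ω, f ω ∂P) * √(∫ ω, g ω ∂P) := by
  have h := integral_mul_le_Lp_mul_Lq_of_nonneg (μ := P) Real.HolderConjugate.two_two
    (ae_of_all P fun ω => Real.sqrt_nonneg (f ω)) (ae_of_all P fun ω => Real.sqrt_nonneg (g ω))
    (by simpa using memLp_two_sqrt hf0 hf) (by simpa using memLp_two_sqrt hg0 hg)
  simpa only [Real.rpow_two, Real.sq_sqrt (hf0 _), Real.sq_sqrt (hg0 _), ← Real.sqrt_eq_rpow]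
    using h

end Integral

lemma abs_sum_mul_succ_le (x : ℕ → ℝ) (n : ℕ) :
    |∑ i ∈ Finset.range (n - 1), x i * x (i + 1)| ≤ ∑ i ∈ Finset.range n, x i ^ 2 := by
  rcases n with _ | m
  · simp
  simp only [Nat.add_sub_cancel]
  have hS : 0 ≤ ∑ i ∈ Finset.range (m + 1), x i ^ 2 := Finset.sum_nonneg fun _ _ => sq_nonneg _
  refine abs_le_of_sq_le_sq ?_ hS
  calc (∑ i ∈ Finset.range m, x i * x (i + 1)) ^ 2
      ≤ (∑ i ∈ Finset.range m, x i ^ 2) * ∑ i ∈ Finset.range m, x (i + 1) ^ 2 :=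
        Finset.sum_mul_sq_le_sq_mul_sq _ _ _
    _ ≤ (∑ i ∈ Finset.range (m + 1), x i ^ 2) * ∑ i ∈ Finset.range (m + 1), x i ^ 2 := by
        refine mul_le_mul ?_ ?_ (Finset.sum_nonneg fun _ _ => sq_nonneg _) hS
        · rw [Finset.sum_range_succ]
          exact le_add_of_nonneg_right (sq_nonneg _)
        · rw [Finset.sum_range_succ']
          exact le_add_of_nonneg_right (sq_nonneg _)
    _ = _ := (sq _).symm

section Estimator

variable {Ω : Type*} {η : ℕ → ℕ → Ω → ℝ}

lemma sq_rhoHat_le (n j : ℕ) (ω : Ω) :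
    rhoHat η n j ω ^ 2 ≤ ((n : ℝ) / ((n : ℝ) - 1)) ^ 2 := by
  refine sq_le_sq.2 ?_
  rw [rhoHat, mul_div_assoc, abs_mul, abs_div (∑ i ∈ _, _)]
  refine mul_le_of_le_one_right (abs_nonneg _) (div_le_one_of_le₀ ?_ (abs_nonneg _))
  exact (abs_sum_mul_succ_le (fun i => η j i ω) n).trans (le_abs_self _)

/-- The squared estimation error is controlled by the errors of the empirical autocovariance and
of the empirical variance. -/
lemma sq_sub_rhoHat_le {n j : ℕ} (hn : 2 ≤ n) (r : ℝ) {ω : Ω}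
    (hpos : 0 < ∑ i ∈ Finset.range n, η j i ω ^ 2) :
    (r - rhoHat η n j ω) ^ 2 ≤
      2 * (r - 1 / ((n : ℝ) - 1) * ∑ i ∈ Finset.range (n - 1), η j i ω * η j (i + 1) ω) ^ 2 +
        2 * ((n : ℝ) / ((n : ℝ) - 1)) ^ 2 *
          (1 - 1 / (n : ℝ) * ∑ i ∈ Finset.range n, η j i ω ^ 2) ^ 2 := by
  have hn' : (2 : ℝ) ≤ n := by exact_mod_cast hn
  have hn1 : (n : ℝ) - 1 ≠ 0 := by linarith
  have hn0 : (n : ℝ) ≠ 0 := by linarith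
  have hb := sq_rhoHat_le (η := η) n j ω
  have hB : 1 / ((n : ℝ) - 1) * ∑ i ∈ Finset.range (n - 1), η j i ω * η j (i + 1) ω =
      rhoHat η n j ω * (1 / (n : ℝ) * ∑ i ∈ Finset.range n, η j i ω ^ 2) := by
    rw [rhoHat]
    field_simp
  rw [hB]
  set R := rhoHat η n j ω
  set A := 1 / (n : ℝ) * ∑ i ∈ Finset.range n, η j i ω ^ 2
  nlinarith [sq_nonneg ((r - R * A) + R * (1 - A)),
    mul_le_mul_of_nonneg_right hb (sq_nonneg (1 - A))]

lemma measurable_rhoHat [MeasurableSpace Ω] (hηm : ∀ j i, Measurable (η j i)) (n j : ℕ) :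
    Measurable (rhoHat η n j) := by
  unfold rhoHat
  fun_prop

end Estimator

lemma sum_Icc_one_eq_sum_range (f : ℕ → ℝ) (m : ℕ) :
    ∑ j ∈ Finset.Icc 1 m, f j = ∑ j ∈ Finset.range m, f (j + 1) := by
  rw [Finset.range_eq_Ico, Finset.sum_Ico_add' f 0 m 1]
  rfl

lemma tendsto_nat_add_one_tsum (f : ℕ → ℝ) :
    Tendsto (fun m => ∑' j, f (m + 1 + j)) atTop (nhds 0) := by
  refine (tendsto_sum_nat_add fun j => f (j + 1)).congr fun m => tsum_congr fun j => ?_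
  congr 1
  ring

/-- in the coordinate ARH(1) estimation model with standardized coordinates,
the mean absolute prediction error `E‖(ρ − ρ̂_{k_n})(X_{n−1})‖_H` is bounded by
`σ_X · √(g(n))` and tends to `0`. -/
theorem stmt12 {Ω : Type*} [MeasurableSpace Ω] (P : Measure Ω) [IsProbabilityMeasure P]
    (C : ℕ → ℝ) (hCpos : ∀ j, 1 ≤ j → 0 < C j)
    (hCmono : ∀ i j : ℕ, 1 ≤ i → i ≤ j → C j ≤ C i)
    (hCsum : Summable fun j : ℕ => C (j + 1))
    (ρ : ℕ → ℝ) (hρ2 : Summable fun j : ℕ => ρ (j + 1) ^ 2)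
    (η : ℕ → ℕ → Ω → ℝ) (hηm : ∀ j i, Measurable (η j i))
    (hpos : ∀ j n : ℕ, 1 ≤ j → 1 ≤ n →
      ∀ᵐ ω ∂P, 0 < ∑ i ∈ Finset.range n, η j i ω ^ 2)
    (hη2 : ∀ j i : ℕ, 1 ≤ j → ∫ ω, η j i ω ^ 2 ∂P = 1)
    (K1 K2 : ℕ → ℝ) (hK1 : ∀ j, 0 ≤ K1 j) (hK2 : ∀ j, 0 ≤ K2 j)
    (S : ℝ) (hS : ∀ j, 1 ≤ j → K1 j + K2 j ≤ S)
    (hA41int : ∀ n j : ℕ, 2 ≤ n → 1 ≤ j → Integrable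
      (fun ω => (1 - 1 / (n : ℝ) * ∑ i ∈ Finset.range n, η j i ω ^ 2) ^ 2) P)
    (hA41 : ∀ n j : ℕ, 2 ≤ n → 1 ≤ j →
      ∫ ω, (1 - 1 / (n : ℝ) * ∑ i ∈ Finset.range n, η j i ω ^ 2) ^ 2 ∂P ≤ K1 j / n)
    (hA42int : ∀ n j : ℕ, 2 ≤ n → 1 ≤ j → Integrable
      (fun ω => (ρ j - 1 / ((n : ℝ) - 1) *
        ∑ i ∈ Finset.range (n - 1), η j i ω * η j (i + 1) ω) ^ 2) P)
    (hA42 : ∀ n j : ℕ, 2 ≤ n → 1 ≤ j →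
      ∫ ω, (ρ j - 1 / ((n : ℝ) - 1) *
        ∑ i ∈ Finset.range (n - 1), η j i ω * η j (i + 1) ω) ^ 2 ∂P ≤ K2 j / n)
    (k : ℕ → ℕ) (hk : Tendsto k atTop atTop)
    (hA3 : Tendsto (fun n : ℕ => (n : ℝ) * C (k n) ^ 2) atTop atTop) :
    (∀ n : ℕ, 2 ≤ n →
      ∫ ω, Real.sqrt
          ((∑ j ∈ Finset.Icc 1 (k n),
              (ρ j - rhoHat η n j ω) ^ 2 * C j * η j (n - 1) ω ^ 2)
            + ∑' j : ℕ,
                ρ (k n + 1 + j) ^ 2 * C (k n + 1 + j) * η (k n + 1 + j) (n - 1) ω ^ 2) ∂P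
        ≤ Real.sqrt (∑' j : ℕ, C (j + 1)) *
            Real.sqrt
              (2 * S * ((n : ℝ) / ((n : ℝ) - 1)) ^ 2 / (C (k n) ^ 2 * n) *
                  (∑ j ∈ Finset.Icc 1 (k n), C j ^ 2)
                + ∑' j : ℕ, ρ (k n + 1 + j) ^ 2)) ∧
    Tendsto (fun n : ℕ =>
        ∫ ω, Real.sqrt
          ((∑ j ∈ Finset.Icc 1 (k n),
              (ρ j - rhoHat η n j ω) ^ 2 * C j * η j (n - 1) ω ^ 2)
            + ∑' j : ℕ,
                ρ (k n + 1 + j) ^ 2 * C (k n + 1 + j) * η (k n + 1 + j) (n - 1) ω ^ 2) ∂P)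
      atTop (nhds 0) := by
  set T : ℕ → ℝ := fun m => ∑' j : ℕ, ρ (m + 1 + j) ^ 2 with hT
  have hS0 : 0 ≤ S := (add_nonneg (hK1 1) (hK2 1)).trans (hS 1 le_rfl)
  have hT0 : ∀ m, 0 ≤ T m := fun m => tsum_nonneg fun _ => sq_nonneg _
  have hTsum : ∀ m, Summable fun j : ℕ => ρ (m + 1 + j) ^ 2 := fun m =>
    (hρ2.comp_injective (add_right_injective m)).congr fun j => by
      simp only [Function.comp_apply]
      congr 2
      ring
  have hC2sum : Summable fun j : ℕ => C (j + 1) ^ 2 := by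
    refine Summable.of_nonneg_of_le (fun _ => sq_nonneg _) (fun j => ?_) (hCsum.mul_left (C 1))
    rw [sq]
    exact mul_le_mul_of_nonneg_right (hCmono 1 (j + 1) le_rfl (by omega)) (hCpos _ (by omega)).le
  have hηint : ∀ j i : ℕ, 1 ≤ j → Integrable (fun ω => η j i ω ^ 2) P := fun j i hj =>
    integrable_of_integral_eq_one (hη2 j i hj)
  have hdint : ∀ n j : ℕ, 2 ≤ n → 1 ≤ j →
      Integrable (fun ω => (ρ j - rhoHat η n j ω) ^ 2) P ∧
      ∫ ω, (ρ j - rhoHat η n j ω) ^ 2 ∂P ≤ 2 * S * ((n : ℝ) / ((n : ℝ) - 1)) ^ 2 / n := by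
    intro n j hn hj
    have hn' : (2 : ℝ) ≤ n := by exact_mod_cast hn
    have hbound := (hpos j n hj (by omega)).mono fun ω hω => sq_sub_rhoHat_le hn (ρ j) hω
    have hi2 := (hA42int n j hn hj).const_mul 2
    have hi1 := (hA41int n j hn hj).const_mul (2 * ((n : ℝ) / ((n : ℝ) - 1)) ^ 2)
    have hdi : Integrable (fun ω => (ρ j - rhoHat η n j ω) ^ 2) P := by
      refine (hi2.add hi1).mono' ?_ ?_
      · exact ((measurable_const.sub (measurable_rhoHat hηm n j)).pow_const 2).aestronglyMeasurable
      · filter_upwards [hbound] with ω hω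
        rw [Real.norm_of_nonneg (sq_nonneg _)]
        exact hω
    refine ⟨hdi, (integral_mono_ae hdi (hi2.add hi1) hbound).trans ?_⟩
    have hr1 : 1 ≤ ((n : ℝ) / ((n : ℝ) - 1)) ^ 2 :=
      one_le_pow₀ ((one_le_div (by linarith)).2 (by linarith))
    simp only [Pi.add_apply]
    rw [integral_add hi2 hi1, integral_const_mul, integral_const_mul]
    calc _ ≤ 2 * (K2 j / n) + 2 * ((n : ℝ) / ((n : ℝ) - 1)) ^ 2 * (K1 j / n) := by
          gcongr
          · exact hA42 n j hn hj
          · exact hA41 n j hn hj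
      _ ≤ 2 * ((n : ℝ) / ((n : ℝ) - 1)) ^ 2 * (K2 j / n) +
          2 * ((n : ℝ) / ((n : ℝ) - 1)) ^ 2 * (K1 j / n) := by
          have := div_nonneg (hK2 j) (by linarith : (0 : ℝ) ≤ n)
          gcongr
          linarith
      _ = 2 * (K1 j + K2 j) * ((n : ℝ) / ((n : ℝ) - 1)) ^ 2 / n := by ring
      _ ≤ _ := by
          gcongr
          exact hS j hj
  have hdsum : ∀ n : ℕ, 2 ≤ n →
      ∫ ω, ∑ j ∈ Finset.Icc 1 (k n), (ρ j - rhoHat η n j ω) ^ 2 ∂P ≤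
        2 * S * ((n : ℝ) / ((n : ℝ) - 1)) ^ 2 / (C (k n) ^ 2 * n) *
          ∑ j ∈ Finset.Icc 1 (k n), C j ^ 2 := by
    intro n hn
    rw [integral_finsetSum _ fun j hj => (hdint n j hn (Finset.mem_Icc.1 hj).1).1, Finset.mul_sum]
    refine Finset.sum_le_sum fun j hj => (hdint n j hn (Finset.mem_Icc.1 hj).1).2.trans ?_
    obtain ⟨hj1, hjk⟩ := Finset.mem_Icc.1 hj
    have hCk : 0 < C (k n) := hCpos _ (hj1.trans hjk)
    have hratio : 1 ≤ C j ^ 2 / C (k n) ^ 2 :=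
      (one_le_div (by positivity)).2 (pow_le_pow_left₀ hCk.le (hCmono j (k n) hj1 hjk) 2)
    calc _ ≤ 2 * S * ((n : ℝ) / ((n : ℝ) - 1)) ^ 2 / n * (C j ^ 2 / C (k n) ^ 2) :=
          le_mul_of_one_le_right (by positivity) hratio
      _ = _ := by
          rw [div_mul_div_comm, div_mul_eq_mul_div, mul_comm (n : ℝ) (C (k n) ^ 2)]
  have hmain : ∀ n : ℕ, 2 ≤ n →
      ∫ ω, Real.sqrt
          ((∑ j ∈ Finset.Icc 1 (k n),
              (ρ j - rhoHat η n j ω) ^ 2 * C j * η j (n - 1) ω ^ 2)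
            + ∑' j : ℕ,
                ρ (k n + 1 + j) ^ 2 * C (k n + 1 + j) * η (k n + 1 + j) (n - 1) ω ^ 2) ∂P
        ≤ Real.sqrt (∑' j : ℕ, C (j + 1)) *
            Real.sqrt
              (2 * S * ((n : ℝ) / ((n : ℝ) - 1)) ^ 2 / (C (k n) ^ 2 * n) *
                  (∑ j ∈ Finset.Icc 1 (k n), C j ^ 2) + T (k n)) := by
    intro n hn
    have hF0 : ∀ (j : ℕ) (ω : Ω), 0 ≤ C (j + 1) * η (j + 1) (n - 1) ω ^ 2 := fun j ω =>
      mul_nonneg (hCpos _ (by omega)).le (sq_nonneg _)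
    have hFint : ∀ j : ℕ, Integrable (fun ω => C (j + 1) * η (j + 1) (n - 1) ω ^ 2) P := fun j =>
      (hηint (j + 1) (n - 1) (by omega)).const_mul _
    have hFval : ∀ j : ℕ, ∫ ω, C (j + 1) * η (j + 1) (n - 1) ω ^ 2 ∂P = C (j + 1) := fun j => by
      rw [integral_const_mul, hη2 _ _ (by omega), mul_one]
    obtain ⟨hWae, hWint⟩ := ae_summable_and_integrable_tsum hF0 hFint
      (by simpa only [hFval] using hCsum)
    have hWval : ∫ ω, ∑' j : ℕ, C (j + 1) * η (j + 1) (n - 1) ω ^ 2 ∂P = ∑' j : ℕ, C (j + 1) := by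
      rw [← integral_tsum_of_summable_integral_norm hFint
        (by simpa only [Real.norm_of_nonneg (hF0 _ _), hFval] using hCsum)]
      simp only [hFval]
    set W : Ω → ℝ := fun ω => ∑' j : ℕ, C (j + 1) * η (j + 1) (n - 1) ω ^ 2
    set D : Ω → ℝ := fun ω =>
      ∑ j ∈ Finset.Icc 1 (k n), (ρ j - rhoHat η n j ω) ^ 2 + T (k n) with hD
    have hW0 : 0 ≤ W := fun ω => tsum_nonneg fun j => hF0 j ω
    have hD0 : 0 ≤ D := fun ω =>
      add_nonneg (Finset.sum_nonneg fun _ _ => sq_nonneg _) (hT0 _)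
    have hdi : Integrable
        (fun ω => ∑ j ∈ Finset.Icc 1 (k n), (ρ j - rhoHat η n j ω) ^ 2) P :=
      integrable_finsetSum _ fun j hj => (hdint n j hn (Finset.mem_Icc.1 hj).1).1
    have hDint : Integrable D P := hdi.add (integrable_const _)
    have hDval : ∫ ω, D ω ∂P ≤ 2 * S * ((n : ℝ) / ((n : ℝ) - 1)) ^ 2 / (C (k n) ^ 2 * n) *
        (∑ j ∈ Finset.Icc 1 (k n), C j ^ 2) + T (k n) := by
      rw [hD, integral_add hdi (integrable_const _)]
      simpa using hdsum n hn
    rw [← hWval, mul_comm]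
    refine le_trans ?_ ((integral_sqrt_mul_sqrt_le hD0 hW0 hDint hWint).trans
      (mul_le_mul_of_nonneg_right (Real.sqrt_le_sqrt hDval) (Real.sqrt_nonneg _)))
    refine integral_mono_of_nonneg (ae_of_all _ fun ω => Real.sqrt_nonneg _)
      ((memLp_two_sqrt hD0 hDint).integrable_mul (memLp_two_sqrt hW0 hWint)) ?_
    filter_upwards [hWae] with ω hω
    have hle : ∀ j, 1 ≤ j → C j * η j (n - 1) ω ^ 2 ≤ W ω := by
      intro j hj
      obtain ⟨i, rfl⟩ := Nat.exists_eq_add_of_le' hj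
      exact hω.le_tsum i fun i' _ => hF0 i' ω
    rw [← Real.sqrt_mul (hD0 ω)]
    refine Real.sqrt_le_sqrt ?_
    rw [hD, add_mul, Finset.sum_mul, hT, ← tsum_mul_right]
    have htail : ∀ j : ℕ, ρ (k n + 1 + j) ^ 2 * C (k n + 1 + j) *
        η (k n + 1 + j) (n - 1) ω ^ 2 ≤ ρ (k n + 1 + j) ^ 2 * W ω := fun j => by
      rw [mul_assoc]
      exact mul_le_mul_of_nonneg_left (hle _ (by omega)) (sq_nonneg _)
    refine add_le_add (Finset.sum_le_sum fun j hj => ?_)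
      (Summable.tsum_le_tsum htail ?_ ((hTsum _).mul_right _))
    · rw [mul_assoc]
      exact mul_le_mul_of_nonneg_left (hle j (Finset.mem_Icc.1 hj).1) (sq_nonneg _)
    · exact Summable.of_nonneg_of_le (fun j => mul_nonneg (mul_nonneg (sq_nonneg _)
        (hCpos _ (by omega)).le) (sq_nonneg _)) htail ((hTsum _).mul_right _)
  refine ⟨hmain, ?_⟩
  set M : ℝ := ∑' j : ℕ, C (j + 1) ^ 2
  have hlim : Tendsto (fun n : ℕ => √(∑' j : ℕ, C (j + 1)) *
      √(2 * S * 2 ^ 2 * M * ((n : ℝ) * C (k n) ^ 2)⁻¹ + T (k n))) atTop (nhds 0) := by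
    have h := ((hA3.inv_tendsto_atTop.const_mul (2 * S * 2 ^ 2 * M)).add
      ((tendsto_nat_add_one_tsum fun j => ρ j ^ 2).comp hk)).sqrt.const_mul
        (√(∑' j : ℕ, C (j + 1)))
    simpa using h
  refine tendsto_of_tendsto_of_tendsto_of_le_of_le' tendsto_const_nhds hlim
    (Eventually.of_forall fun n => integral_nonneg fun ω => Real.sqrt_nonneg _) ?_
  filter_upwards [eventually_ge_atTop 2] with n hn
  refine (hmain n hn).trans (mul_le_mul_of_nonneg_left (Real.sqrt_le_sqrt ?_) (Real.sqrt_nonneg _))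
  have hn' : (2 : ℝ) ≤ n := by exact_mod_cast hn
  have hr0 : 0 ≤ (n : ℝ) / ((n : ℝ) - 1) := div_nonneg (by linarith) (by linarith)
  have hr : (n : ℝ) / ((n : ℝ) - 1) ≤ 2 := (div_le_iff₀ (by linarith)).2 (by linarith)
  have hMle : ∑ j ∈ Finset.Icc 1 (k n), C j ^ 2 ≤ M := by
    rw [sum_Icc_one_eq_sum_range]
    exact hC2sum.sum_le_tsum _ fun _ _ => sq_nonneg _
  have hM0 : 0 ≤ ∑ j ∈ Finset.Icc 1 (k n), C j ^ 2 := Finset.sum_nonneg fun _ _ => sq_nonneg _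
  refine add_le_add_left ?_ _
  calc _ ≤ 2 * S * 2 ^ 2 / (C (k n) ^ 2 * n) * M := by gcongr
    _ = _ := by
        rw [mul_comm (n : ℝ) (C (k n) ^ 2)]
        ring
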